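/- Let p ∈ (0,1) be constant and b = 1/(1−p). There is n₀ such that for all n ≥ n₀, every integer a with 1 ≤ a ≤ n satisfying 1.02 log_b n ≤ a ≤ 99 log_b n and μ ≤ n^{1.98}, where μ = binom(n,a)(1−p)^{binom(a,2)}, and every integer r ≤ √μ, there is a coupling of the random graphs G_n = G_{n,p} and G_{n+ar} = G_{n+ar,p} with the property that P(χ(G_{n+ar}) ≤ χ(G_n) + r) > 0.4. -/

import Mathlib

open Filter Real

/-- Number of edges of a graph on `Fin n`. -/
noncomputable def edgeCount {n : ℕ} (G : SimpleGraph (Fin n)) : ℕ := G.edgeSet.ncard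

/-- The probability that the binomial random graph `G_{n,p}` equals `G`. -/
noncomputable def gnpWeight (n : ℕ) (p : ℝ) (G : SimpleGraph (Fin n)) : ℝ :=
  p ^ edgeCount G * (1 - p) ^ (n.choose 2 - edgeCount G)

/-- The chromatic number, as a natural number. -/
noncomputable def chrom {n : ℕ} (G : SimpleGraph (Fin n)) : ℕ := G.chromaticNumber.toNat

/-- `μ_a(n) = C(n,a) q^C(a,2)` where `q = 1-p`. -/
noncomputable def muNat (n a : ℕ) (q : ℝ) : ℝ := (n.choose a : ℝ) * q ^ a.choose 2

/-- A coupling of the random graphs `G_{n,p}` and `G_{m,p}`: a joint distribution on pairs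
of graphs whose marginals are `G_{n,p}` and `G_{m,p}`. -/
structure Coupling (p : ℝ) (n m : ℕ) where
  w : SimpleGraph (Fin n) × SimpleGraph (Fin m) → ℝ
  nonneg : ∀ x, 0 ≤ w x
  margFst : ∀ G : SimpleGraph (Fin n), (∑ H : SimpleGraph (Fin m), w (G, H)) = gnpWeight n p G
  margSnd : ∀ H : SimpleGraph (Fin m), (∑ G : SimpleGraph (Fin n), w (G, H)) = gnpWeight m p H

open scoped Classical in
/-- The probability of an event under a coupling. -/
noncomputable def couplingProb {p : ℝ} {n m : ℕ} (c : Coupling p n m)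
    (E : Set (SimpleGraph (Fin n) × SimpleGraph (Fin m))) : ℝ :=
  ∑ x : SimpleGraph (Fin n) × SimpleGraph (Fin m), if x ∈ E then c.w x else 0

/-- `w` is a joint weight function with marginals `f` and `g`. -/
structure IsCoupling {α β : Type*} [Fintype α] [Fintype β] (w : α → β → ℝ)
    (f : α → ℝ) (g : β → ℝ) : Prop where
  nonneg : ∀ x y, 0 ≤ w x y
  sum_right : ∀ x, ∑ y, w x y = f x
  sum_left : ∀ y, ∑ x, w x y = g y

open scoped Classical in
/-- The total weight of the pairs violating the relation `R`. -/
noncomputable def violation {α β : Type*} [Fintype α] [Fintype β] (w : α → β → ℝ)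
    (R : α → β → Prop) : ℝ :=
  ∑ x, ∑ y, if R x y then 0 else w x y

/-- `f` and `g` admit a coupling which violates `R` with weight at most `ε`. -/
def HasCoupling {α β : Type*} [Fintype α] [Fintype β] (f : α → ℝ) (g : β → ℝ)
    (R : α → β → Prop) (ε : ℝ) : Prop :=
  ∃ w, IsCoupling w f g ∧ violation w R ≤ ε

namespace HasCoupling

variable {α β γ : Type*} [Fintype α] [Fintype β] [Fintype γ]

theorem mono {f : α → ℝ} {g : β → ℝ} {R : α → β → Prop} {ε δ : ℝ}
    (h : HasCoupling f g R ε) (hεδ : ε ≤ δ) : HasCoupling f g R δ := by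
  obtain ⟨w, hw, hf⟩ := h
  exact ⟨w, hw, hf.trans hεδ⟩

theorem refl {f : α → ℝ} (hf : ∀ x, 0 ≤ f x) {R : α → α → Prop} (hR : ∀ x, R x x) :
    HasCoupling f f R 0 := by
  classical
  refine ⟨fun x y => if x = y then f x else 0, ⟨?_, ?_, ?_⟩, ?_⟩
  · intro x y
    split_ifs
    exacts [hf x, le_rfl]
  · intro x
    simp
  · intro y
    simp
  · refine (Finset.sum_eq_zero fun x _ => Finset.sum_eq_zero fun y _ => ?_).le
    by_cases hxy : x = y
    · subst hxy
      simp [hR]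
    · simp [hxy]

theorem comp {f : α → ℝ} {g : β → ℝ} {h : γ → ℝ} {R : α → β → Prop} {S : β → γ → Prop}
    {T : α → γ → Prop} {ε δ : ℝ} (hRST : ∀ x y z, R x y → S y z → T x z)
    (h₁ : HasCoupling f g R ε) (h₂ : HasCoupling g h S δ) : HasCoupling f h T (ε + δ) := by
  classical
  obtain ⟨w, hw, hwε⟩ := h₁
  obtain ⟨v, hv, hvδ⟩ := h₂
  have hg : ∀ y, 0 ≤ g y := fun y => by
    rw [← hw.sum_left]; exact Finset.sum_nonneg fun x _ => hw.nonneg x y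
  have hterm : ∀ x y z, 0 ≤ w x y * v y z / g y := fun x y z =>
    div_nonneg (mul_nonneg (hw.nonneg x y) (hv.nonneg y z)) (hg y)
  have hw0 : ∀ x y, g y = 0 → w x y = 0 := fun x y hy =>
    (Finset.sum_eq_zero_iff_of_nonneg fun x _ => hw.nonneg x y).1
      ((hw.sum_left y).trans hy) x (Finset.mem_univ x)
  have hv0 : ∀ y z, g y = 0 → v y z = 0 := fun y z hy =>
    (Finset.sum_eq_zero_iff_of_nonneg fun z _ => hv.nonneg y z).1
      ((hv.sum_right y).trans hy) z (Finset.mem_univ z)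
  have hsumz : ∀ x y, ∑ z, w x y * v y z / g y = w x y := fun x y => by
    rw [← Finset.sum_div, ← Finset.mul_sum, hv.sum_right]
    by_cases hy : g y = 0
    · simp [hw0 x y hy]
    · field_simp
  have hsumx : ∀ y z, ∑ x, w x y * v y z / g y = v y z := fun y z => by
    rw [← Finset.sum_div, ← Finset.sum_mul, hw.sum_left]
    by_cases hy : g y = 0
    · simp [hv0 y z hy]
    · field_simp
  refine ⟨fun x z => ∑ y, w x y * v y z / g y,
    ⟨fun x z => Finset.sum_nonneg fun y _ => hterm x y z, fun x => ?_, fun z => ?_⟩, ?_⟩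
  · rw [Finset.sum_comm]
    simp_rw [hsumz]
    exact hw.sum_right x
  · rw [Finset.sum_comm]
    simp_rw [hsumx]
    exact hv.sum_left z
  · have hle : ∀ x z, (if T x z then 0 else ∑ y, w x y * v y z / g y) ≤
        ∑ y, ((if R x y then 0 else w x y * v y z / g y) +
          if S y z then 0 else w x y * v y z / g y) := by
      intro x z
      have hnn : ∀ y, 0 ≤ (if R x y then 0 else w x y * v y z / g y) +
          if S y z then 0 else w x y * v y z / g y := by
        intro y
        have := hterm x y z
        split_ifs <;> linarith
      split_ifs with hT
      · exact Finset.sum_nonneg fun y _ => hnn y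
      · refine Finset.sum_le_sum fun y _ => ?_
        have := hterm x y z
        have := hRST x y z
        split_ifs with h1 h2 <;> first | linarith | tauto
    have hR : ∑ x, ∑ z, ∑ y, (if R x y then 0 else w x y * v y z / g y) = violation w R := by
      refine Finset.sum_congr rfl fun x _ => ?_
      rw [Finset.sum_comm]
      refine Finset.sum_congr rfl fun y _ => ?_
      split_ifs
      · simp
      · exact hsumz x y
    have hS : ∑ x, ∑ z, ∑ y, (if S y z then 0 else w x y * v y z / g y) = violation v S := by
      rw [Finset.sum_comm]
      simp_rw [fun z => Finset.sum_comm (s := (Finset.univ : Finset α)) (t := Finset.univ)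
        (f := fun x y => if S y z then 0 else w x y * v y z / g y)]
      rw [Finset.sum_comm]
      refine Finset.sum_congr rfl fun y _ => Finset.sum_congr rfl fun z _ => ?_
      split_ifs
      · simp
      · exact hsumx y z
    calc violation (fun x z => ∑ y, w x y * v y z / g y) T
        ≤ ∑ x, ∑ z, ∑ y, ((if R x y then 0 else w x y * v y z / g y) +
          if S y z then 0 else w x y * v y z / g y) :=
          Finset.sum_le_sum fun x _ => Finset.sum_le_sum fun z _ => hle x z
      _ = violation w R + violation v S := by
          simp_rw [Finset.sum_add_distrib]
          rw [hR, hS]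
      _ ≤ ε + δ := add_le_add hwε hvδ

/-- Two weight functions of equal mass can be coupled so that they differ with weight at most
their total variation distance. -/
theorem of_totalVariation {f g : α → ℝ} (hf : ∀ x, 0 ≤ f x) (hg : ∀ x, 0 ≤ g x)
    (hfg : ∑ x, f x = ∑ x, g x) : HasCoupling f g Eq ((∑ x, |f x - g x|) / 2) := by
  classical
  set d : ℝ := (∑ x, |f x - g x|) / 2 with hd
  have hmin : ∀ x, min (f x) (g x) = (f x + g x - |f x - g x|) / 2 := fun x => by
    rcases le_total (f x) (g x) with h | h
    · rw [min_eq_left h, abs_of_nonpos (by linarith)]; ring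
    · rw [min_eq_right h, abs_of_nonneg (by linarith)]; ring
  have hsumf : ∑ x, (f x - min (f x) (g x)) = d := by
    simp_rw [hmin, Finset.sum_sub_distrib, ← Finset.sum_div, Finset.sum_sub_distrib,
      Finset.sum_add_distrib]
    rw [hd, hfg]; ring
  have hsumg : ∑ x, (g x - min (f x) (g x)) = d := by
    simp_rw [hmin, Finset.sum_sub_distrib, ← Finset.sum_div, Finset.sum_sub_distrib,
      Finset.sum_add_distrib]
    rw [hd, hfg]; ring
  have hf' : ∀ x, 0 ≤ f x - min (f x) (g x) := fun x => sub_nonneg.2 (min_le_left _ _)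
  have hg' : ∀ x, 0 ≤ g x - min (f x) (g x) := fun x => sub_nonneg.2 (min_le_right _ _)
  have hd0 : 0 ≤ d := hsumf ▸ Finset.sum_nonneg fun x _ => hf' x
  have hcancel : ∀ {u : α → ℝ}, (∀ x, 0 ≤ u x) → ∑ x, u x = d → ∀ x, u x * d / d = u x := by
    intro u hu hsum x
    by_cases h0 : d = 0
    · have := (Finset.sum_eq_zero_iff_of_nonneg fun x _ => hu x).1 (hsum.trans h0) x
        (Finset.mem_univ x)
      simp [this]
    · field_simp
  have hext : ∀ x y, 0 ≤ (f x - min (f x) (g x)) * (g y - min (f y) (g y)) / d := fun x y =>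
    div_nonneg (mul_nonneg (hf' x) (hg' y)) hd0
  refine ⟨fun x y => (if x = y then min (f x) (g x) else 0) +
    (f x - min (f x) (g x)) * (g y - min (f y) (g y)) / d, ⟨fun x y => ?_, fun x => ?_,
      fun y => ?_⟩, ?_⟩
  · refine add_nonneg ?_ (hext x y)
    split_ifs
    exacts [le_min (hf x) (hg x), le_rfl]
  · rw [Finset.sum_add_distrib, ← Finset.sum_div, ← Finset.mul_sum, hsumg, hcancel hf' hsumf]
    simp
  · rw [Finset.sum_add_distrib, ← Finset.sum_div, ← Finset.sum_mul, hsumf, mul_comm d,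
      hcancel hg' hsumg]
    simp
  · calc _ ≤ ∑ x, ∑ y, (f x - min (f x) (g x)) * (g y - min (f y) (g y)) / d := by
          refine Finset.sum_le_sum fun x _ => Finset.sum_le_sum fun y _ => ?_
          by_cases hxy : x = y
          · simpa [hxy] using hext y y
          · simp [hxy]
      _ = d := by
          simp_rw [← Finset.sum_div, ← Finset.mul_sum, hsumg, ← Finset.sum_mul, hsumf]
          by_cases h0 : d = 0
          · simp [h0]
          · field_simp

end HasCoupling

/-- The two-element subsets of `S`. -/
def pairs {V : Type*} [DecidableEq V] (S : Finset V) : Finset (Sym2 V) :=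
  S.offDiag.image (Function.uncurry Sym2.mk)

theorem card_pairs {V : Type*} [DecidableEq V] (S : Finset V) :
    (pairs S).card = S.card.choose 2 :=
  Sym2.card_image_offDiag S

theorem mk_mem_pairs {V : Type*} [DecidableEq V] {S : Finset V} {x y : V} :
    s(x, y) ∈ pairs S ↔ x ∈ S ∧ y ∈ S ∧ x ≠ y := by
  simp only [pairs, Finset.mem_image, Finset.mem_offDiag, Prod.exists, Function.uncurry_apply_pair,
    Sym2.eq_iff]
  grind

theorem pairs_inter {V : Type*} [DecidableEq V] (S T : Finset V) :
    pairs (S ∩ T) = pairs S ∩ pairs T := by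
  ext e
  induction e with
  | _ x y => simp only [Finset.mem_inter, mk_mem_pairs]; tauto

theorem pairs_mono {V : Type*} [DecidableEq V] {S T : Finset V} (h : S ⊆ T) :
    pairs S ⊆ pairs T := by
  intro e
  induction e with
  | _ x y => simp only [mk_mem_pairs]; exact fun hh => ⟨h hh.1, h hh.2.1, hh.2.2⟩

theorem gnpWeight_pos {n : ℕ} {p : ℝ} (hp0 : 0 < p) (hp1 : p < 1) (G : SimpleGraph (Fin n)) :
    0 < gnpWeight n p G :=
  mul_pos (pow_pos hp0 _) (pow_pos (sub_pos.2 hp1) _)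

open scoped Classical in
theorem edgeCount_eq_card {n : ℕ} (G : SimpleGraph (Fin n)) :
    edgeCount G = G.edgeFinset.card := by
  rw [edgeCount, ← SimpleGraph.coe_edgeFinset, Set.ncard_coe_finset]

open scoped Classical in
theorem edgeFinset_subset_pairs_univ {n : ℕ} (G : SimpleGraph (Fin n)) :
    G.edgeFinset ⊆ pairs Finset.univ := by
  intro e
  induction e with
  | _ x y =>
    simp only [SimpleGraph.mem_edgeFinset, SimpleGraph.mem_edgeSet, mk_mem_pairs,
      Finset.mem_univ, true_and]
    exact fun h => h.ne

theorem edgeFinset_fromEdgeSet_of_subset {n : ℕ} {T : Finset (Sym2 (Fin n))}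
    (hT : T ⊆ pairs Finset.univ)
    {_ : Fintype (SimpleGraph.fromEdgeSet (T : Set (Sym2 (Fin n)))).edgeSet} :
    (SimpleGraph.fromEdgeSet (T : Set (Sym2 (Fin n)))).edgeFinset = T := by
  ext e
  have := @hT e
  induction e with
  | _ x y =>
    simp only [mk_mem_pairs, Finset.mem_univ, true_and] at this
    simp only [SimpleGraph.mem_edgeFinset, SimpleGraph.mem_edgeSet, SimpleGraph.fromEdgeSet_adj,
      Finset.mem_coe]
    tauto

open scoped Classical in
/-- The probability that the edge set of `G_{n,p}` meets `A` exactly in `B`. -/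
theorem sum_gnpWeight_edgeFinset_inter {n : ℕ} (p : ℝ) {A B : Finset (Sym2 (Fin n))}
    (hA : A ⊆ pairs Finset.univ) (hB : B ⊆ A) :
    ∑ H : SimpleGraph (Fin n), (if H.edgeFinset ∩ A = B then gnpWeight n p H else 0) =
      p ^ B.card * (1 - p) ^ (A.card - B.card) := by
  set E : Finset (Sym2 (Fin n)) := pairs Finset.univ with hE
  have hcardE : E.card = n.choose 2 := by simp [hE, card_pairs]
  have hone : ∑ T ∈ (E \ A).powerset, p ^ T.card * (1 - p) ^ ((E \ A).card - T.card) = 1 := by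
    rw [Finset.sum_pow_mul_eq_add_pow]; simp
  have hrhs : p ^ B.card * (1 - p) ^ (A.card - B.card) =
      ∑ T ∈ (E \ A).powerset, p ^ B.card * (1 - p) ^ (A.card - B.card) *
        (p ^ T.card * (1 - p) ^ ((E \ A).card - T.card)) := by
    rw [← Finset.mul_sum, hone, mul_one]
  rw [hrhs, ← Finset.sum_filter]
  refine Finset.sum_bij' (fun H _ => H.edgeFinset \ A)
    (fun T _ => SimpleGraph.fromEdgeSet ((T ∪ B : Finset (Sym2 (Fin n))) : Set (Sym2 (Fin n))))
    ?_ ?_ ?_ ?_ ?_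
  · intro H _
    exact Finset.mem_powerset.2 (Finset.sdiff_subset_sdiff (edgeFinset_subset_pairs_univ H)
      le_rfl)
  · intro T hT
    have hT := Finset.mem_powerset.1 hT
    have hTB : T ∪ B ⊆ E := Finset.union_subset (hT.trans Finset.sdiff_subset) (hB.trans hA)
    rw [Finset.mem_filter]
    refine ⟨Finset.mem_univ _, ?_⟩
    rw [edgeFinset_fromEdgeSet_of_subset hTB]
    ext e
    have h1 := @hT e
    have h2 := @hB e
    simp only [Finset.mem_sdiff, Finset.mem_inter, Finset.mem_union] at *
    tauto
  · intro H hH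
    have hH := (Finset.mem_filter.1 hH).2
    have : H.edgeFinset \ A ∪ B = H.edgeFinset := by
      rw [← hH]; exact Finset.sdiff_union_inter _ _
    rw [this, SimpleGraph.coe_edgeFinset, SimpleGraph.fromEdgeSet_edgeSet]
  · intro T hT
    have hT := Finset.mem_powerset.1 hT
    have hTB : T ∪ B ⊆ E := Finset.union_subset (hT.trans Finset.sdiff_subset) (hB.trans hA)
    rw [edgeFinset_fromEdgeSet_of_subset hTB]
    ext e
    have h1 := @hT e
    have h2 := @hB e
    simp only [Finset.mem_sdiff, Finset.mem_union] at *
    tauto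
  · intro H hH
    have hH := (Finset.mem_filter.1 hH).2
    have h1 : (H.edgeFinset \ A).card + B.card = H.edgeFinset.card := by
      rw [← hH]; exact Finset.card_sdiff_add_card_inter _ _
    have h2 : (E \ A).card + A.card = E.card := Finset.card_sdiff_add_card_eq_card hA
    have h3 : B.card ≤ A.card := Finset.card_le_card hB
    have h4 : (H.edgeFinset \ A).card ≤ (E \ A).card := Finset.card_le_card
      (Finset.sdiff_subset_sdiff (edgeFinset_subset_pairs_univ H) le_rfl)
    rw [gnpWeight, edgeCount_eq_card, ← hcardE, ← h1, ← h2,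
      show (E \ A).card + A.card - ((H.edgeFinset \ A).card + B.card) =
        (A.card - B.card) + ((E \ A).card - (H.edgeFinset \ A).card) by omega, pow_add, pow_add]
    ring

theorem sum_gnpWeight (n : ℕ) (p : ℝ) : ∑ G : SimpleGraph (Fin n), gnpWeight n p G = 1 := by
  classical
  simpa using sum_gnpWeight_edgeFinset_inter p (A := (∅ : Finset (Sym2 (Fin n))))
    (Finset.empty_subset _) (Finset.Subset.refl _)

open scoped Classical in
theorem isIndepSet_iff_edgeFinset_inter_pairs {n : ℕ} {H : SimpleGraph (Fin n)}
    {S : Finset (Fin n)} : H.IsIndepSet S ↔ H.edgeFinset ∩ pairs S = ∅ := by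
  rw [← Finset.disjoint_iff_inter_eq_empty, Finset.disjoint_left]
  constructor
  · intro h e
    induction e with
    | _ x y =>
      simp only [SimpleGraph.mem_edgeFinset, SimpleGraph.mem_edgeSet, mk_mem_pairs]
      exact fun hxy hS => h hS.1 hS.2.1 hS.2.2 hxy
  · intro h x hx y hy hxy hadj
    exact h (SimpleGraph.mem_edgeFinset.2 hadj) (mk_mem_pairs.2 ⟨hx, hy, hxy⟩)

open scoped Classical in
/-- The number of independent sets of size `a`. -/
noncomputable def numIndep {n : ℕ} (a : ℕ) (H : SimpleGraph (Fin n)) : ℝ :=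
  ∑ S ∈ Finset.powersetCard a (Finset.univ : Finset (Fin n)), if H.IsIndepSet S then 1 else 0

/-- The distribution of `G_{n,p}` after all edges inside a random `a`-set are removed. -/
noncomputable def plantedWeight (n : ℕ) (p : ℝ) (a : ℕ) (H : SimpleGraph (Fin n)) : ℝ :=
  gnpWeight n p H * numIndep a H / muNat n a (1 - p)

theorem muNat_pos {n a : ℕ} {q : ℝ} (ha : a ≤ n) (hq : 0 < q) : 0 < muNat n a q :=
  mul_pos (Nat.cast_pos.2 (Nat.choose_pos ha)) (pow_pos hq _)

theorem numIndep_nonneg {n : ℕ} (a : ℕ) (H : SimpleGraph (Fin n)) : 0 ≤ numIndep a H :=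
  Finset.sum_nonneg fun S _ => by split_ifs <;> norm_num

theorem sum_gnpWeight_isIndepSet {n : ℕ} (p : ℝ) (S : Finset (Fin n))
    [∀ H : SimpleGraph (Fin n), Decidable (H.IsIndepSet S)] :
    ∑ H : SimpleGraph (Fin n), (if H.IsIndepSet S then gnpWeight n p H else 0) =
      (1 - p) ^ S.card.choose 2 := by
  classical
  simpa [isIndepSet_iff_edgeFinset_inter_pairs, card_pairs] using
    sum_gnpWeight_edgeFinset_inter p (pairs_mono S.subset_univ) (Finset.empty_subset _)

theorem sum_gnpWeight_isIndepSet_and {n : ℕ} (p : ℝ) (S T : Finset (Fin n))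
    [∀ H : SimpleGraph (Fin n), Decidable (H.IsIndepSet S ∧ H.IsIndepSet T)] :
    ∑ H : SimpleGraph (Fin n), (if H.IsIndepSet S ∧ H.IsIndepSet T then gnpWeight n p H else 0) =
      (1 - p) ^ (pairs S ∪ pairs T).card := by
  classical
  simpa [isIndepSet_iff_edgeFinset_inter_pairs, Finset.inter_union_distrib_left,
    Finset.union_eq_empty] using
    sum_gnpWeight_edgeFinset_inter p
      (Finset.union_subset (pairs_mono S.subset_univ) (pairs_mono T.subset_univ))
      (Finset.empty_subset _)

theorem sum_gnpWeight_mul_numIndep (n : ℕ) (p : ℝ) (a : ℕ) :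
    ∑ H : SimpleGraph (Fin n), gnpWeight n p H * numIndep a H = muNat n a (1 - p) := by
  classical
  simp_rw [numIndep, Finset.mul_sum, mul_ite, mul_one, mul_zero]
  rw [Finset.sum_comm, muNat, Finset.sum_congr rfl
    (fun S hS => (sum_gnpWeight_isIndepSet p S).trans
      (by rw [(Finset.mem_powersetCard.1 hS).2]))]
  simp

theorem chrom_le_of_colorable {n k : ℕ} {G : SimpleGraph (Fin n)} (h : G.Colorable k) :
    chrom G ≤ k := by
  simpa [chrom] using ENat.toNat_le_toNat h.chromaticNumber_le (ENat.natCast_ne_top k)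

theorem colorable_add_one_of_comap {m n k : ℕ} {H : SimpleGraph (Fin n)} {S : Finset (Fin n)}
    (hS : H.IsIndepSet S) {f : Fin m → Fin n} (hf : ∀ x ∉ S, ∃ i, f i = x)
    (h : (H.comap f).Colorable k) : H.Colorable (k + 1) := by
  classical
  obtain ⟨C⟩ := h
  choose g hg using hf
  refine ⟨SimpleGraph.Coloring.mk
    (fun x => if hx : x ∈ S then Fin.last k else (C (g x hx)).castSucc) ?_⟩
  intro x y hxy
  by_cases hx : x ∈ S <;> by_cases hy : y ∈ S
  · exact absurd hxy (hS hx hy hxy.ne)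
  · simpa [hx, hy] using (Fin.castSucc_lt_last (C (g y hy))).ne'
  · simp [hx, hy]
  · have : C (g x hx) ≠ C (g y hy) := C.valid (by simpa [hg x hx, hg y hy] using hxy)
    simpa [hx, hy] using this

theorem chrom_le_chrom_comap_add_one {m n : ℕ} {H : SimpleGraph (Fin n)} {S : Finset (Fin n)}
    (hS : H.IsIndepSet S) {f : Fin m → Fin n} (hf : ∀ x ∉ S, ∃ i, f i = x) :
    chrom H ≤ chrom (H.comap f) + 1 :=
  chrom_le_of_colorable (colorable_add_one_of_comap hS hf
    (SimpleGraph.colorable_chromaticNumber_of_fintype _))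

theorem sum_gnpWeight_isIndepSet_comap {m n : ℕ} (p : ℝ) (S : Finset (Fin n))
    (f : Fin m ↪ Fin n) (hf : ∀ i, f i ∉ S) (G : SimpleGraph (Fin m))
    [∀ H : SimpleGraph (Fin n), Decidable (H.IsIndepSet S ∧ H.comap f = G)] :
    ∑ H : SimpleGraph (Fin n), (if H.IsIndepSet S ∧ H.comap f = G then gnpWeight n p H else 0) =
      (1 - p) ^ S.card.choose 2 * gnpWeight m p G := by
  classical
  set P : Finset (Sym2 (Fin n)) := (pairs Finset.univ).image (Sym2.map f) with hP
  set B : Finset (Sym2 (Fin n)) := G.edgeFinset.image (Sym2.map f) with hB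
  have hinj : Function.Injective (Sym2.map f) := Sym2.map.injective f.injective
  have hBP : B ⊆ P := Finset.image_subset_image (edgeFinset_subset_pairs_univ G)
  have hPE : P ⊆ pairs Finset.univ := by
    intro e he
    obtain ⟨e', he', rfl⟩ := Finset.mem_image.1 he
    induction e' with
    | _ x y => simpa [mk_mem_pairs] using he'
  have hPS : Disjoint (pairs S) P := by
    rw [Finset.disjoint_left]
    intro e heS he
    obtain ⟨e', he', rfl⟩ := Finset.mem_image.1 he
    induction e' with
    | _ x y => exact hf x (mk_mem_pairs.1 heS).1
  have hcomap : ∀ H : SimpleGraph (Fin n), H.comap f = G ↔ H.edgeFinset ∩ P = B := by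
    intro H
    have himg : H.edgeFinset ∩ P = (H.comap f).edgeFinset.image (Sym2.map f) := by
      ext e
      simp only [hP, Finset.mem_inter, Finset.mem_image]
      constructor
      · rintro ⟨he, e', -, rfl⟩
        refine ⟨e', ?_, rfl⟩
        induction e' with
        | _ x y => simpa using he
      · rintro ⟨e', he', rfl⟩
        refine ⟨?_, e', edgeFinset_subset_pairs_univ _ he', rfl⟩
        induction e' with
        | _ x y => simpa using he'
    rw [himg, hB, (Finset.image_injective hinj).eq_iff, SimpleGraph.edgeFinset_inj]
  have hiff : ∀ H : SimpleGraph (Fin n), H.IsIndepSet S ∧ H.comap f = G ↔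
      H.edgeFinset ∩ (pairs S ∪ P) = B := by
    intro H
    rw [hcomap, isIndepSet_iff_edgeFinset_inter_pairs, Finset.inter_union_distrib_left]
    constructor
    · rintro ⟨h1, h2⟩
      rw [h1, h2, Finset.empty_union]
    · intro h
      have h1 : H.edgeFinset ∩ pairs S = ∅ := by
        rw [← Finset.disjoint_self_iff_empty]
        refine (Finset.disjoint_of_subset_left Finset.inter_subset_right hPS).mono_right ?_
        exact (Finset.subset_union_left.trans h.subset).trans hBP
      exact ⟨h1, by rwa [h1, Finset.empty_union] at h⟩
  have key := sum_gnpWeight_edgeFinset_inter p (Finset.union_subset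
    (pairs_mono S.subset_univ) hPE) (hBP.trans Finset.subset_union_right)
  have hle : G.edgeFinset.card ≤ m.choose 2 := by
    simpa [card_pairs] using Finset.card_le_card (edgeFinset_subset_pairs_univ G)
  rw [Finset.card_union_of_disjoint hPS, hP, hB, Finset.card_image_of_injective _ hinj,
    Finset.card_image_of_injective _ hinj, card_pairs, card_pairs, Finset.card_univ,
    Fintype.card_fin, Nat.add_sub_assoc hle, pow_add] at key
  rw [gnpWeight, edgeCount_eq_card]
  simp_rw [hiff]
  rw [key]
  ring

/-- Planting an independent set of size `a` costs at most one new colour. -/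
theorem hasCoupling_plantedWeight {p : ℝ} (hp0 : 0 < p) (hp1 : p < 1) (m a : ℕ) :
    HasCoupling (gnpWeight m p) (plantedWeight (m + a) p a)
      (fun G H => chrom H ≤ chrom G + 1) 0 := by
  classical
  have hex : ∀ S : Finset (Fin (m + a)), S.card = a →
      ∃ f : Fin m ↪ Fin (m + a), (∀ i, f i ∉ S) ∧ ∀ x ∉ S, ∃ i, f i = x := by
    intro S hS
    have hc : Sᶜ.card = m := by rw [Finset.card_compl, hS]; simp
    refine ⟨(Sᶜ.orderEmbOfFin hc).toEmbedding, fun i => ?_, fun x hx => ?_⟩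
    · exact Finset.mem_compl.1 (Finset.orderEmbOfFin_mem Sᶜ hc i)
    · have : x ∈ Set.range (Sᶜ.orderEmbOfFin hc) := by
        rw [Finset.range_orderEmbOfFin]; simpa using hx
      exact this
  have hne : Nonempty (Fin m ↪ Fin (m + a)) := ⟨Fin.castAddEmb a⟩
  choose! f hfS hfc using hex
  have hμ : 0 < muNat (m + a) a (1 - p) := muNat_pos (Nat.le_add_left a m) (sub_pos.2 hp1)
  refine ⟨fun G H => ∑ S ∈ Finset.powersetCard a Finset.univ,
    if H.IsIndepSet S ∧ H.comap (f S) = G then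
      gnpWeight (m + a) p H / muNat (m + a) a (1 - p) else 0, ⟨?_, ?_, ?_⟩, ?_⟩
  · intro G H
    refine Finset.sum_nonneg fun S _ => ?_
    split_ifs
    exacts [div_nonneg (gnpWeight_pos hp0 hp1 H).le hμ.le, le_rfl]
  · intro G
    rw [Finset.sum_comm]
    have hterm : ∀ S ∈ Finset.powersetCard a (Finset.univ : Finset (Fin (m + a))),
        ∑ H : SimpleGraph (Fin (m + a)), (if H.IsIndepSet S ∧ H.comap (f S) = G then
          gnpWeight (m + a) p H / muNat (m + a) a (1 - p) else 0) =
        (1 - p) ^ a.choose 2 * gnpWeight m p G / muNat (m + a) a (1 - p) := by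
      intro S hS
      have hS := (Finset.mem_powersetCard.1 hS).2
      have := sum_gnpWeight_isIndepSet_comap p S (f S) (hfS S hS) G
      rw [hS] at this
      rw [← this, Finset.sum_div]
      refine Finset.sum_congr rfl fun H _ => ?_
      split_ifs <;> simp
    rw [Finset.sum_congr rfl hterm, Finset.sum_const, Finset.card_powersetCard, nsmul_eq_mul,
      Finset.card_univ, Fintype.card_fin, mul_div_assoc', div_eq_iff hμ.ne', muNat]
    ring
  · intro H
    rw [Finset.sum_comm, plantedWeight, numIndep, Finset.mul_sum, Finset.sum_div]
    refine Finset.sum_congr rfl fun S _ => ?_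
    by_cases hS : H.IsIndepSet S <;> simp [hS]
  · refine (Finset.sum_eq_zero fun G _ => Finset.sum_eq_zero fun H _ => ?_).le
    split_ifs with h
    · rfl
    · refine Finset.sum_eq_zero fun S hS => if_neg ?_
      rintro ⟨hI, rfl⟩
      exact h (chrom_le_chrom_comap_add_one hI (hfc S (Finset.mem_powersetCard.1 hS).2))

theorem inv_pow_choose_two_card_inter_sub_one_le {V : Type*} [DecidableEq V] {q : ℝ} (hq : 0 < q)
    {a : ℕ} {S T : Finset V} (hS : S.card = a) :
    (q ^ (S ∩ T).card.choose 2)⁻¹ - 1 ≤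
      ∑ l ∈ Finset.Icc 2 a, ∑ U ∈ Finset.powersetCard l S,
        if U ⊆ T then (q ^ l.choose 2)⁻¹ else 0 := by
  have hnn : ∀ l : ℕ, ∀ U ∈ Finset.powersetCard l S,
      0 ≤ if U ⊆ T then (q ^ l.choose 2)⁻¹ else 0 := fun l U _ => by
    split_ifs <;> positivity
  by_cases hc : 2 ≤ (S ∩ T).card
  · have hca : (S ∩ T).card ≤ a := hS ▸ Finset.card_le_card Finset.inter_subset_left
    refine le_trans ?_ (Finset.single_le_sum (fun l _ => Finset.sum_nonneg (hnn l))
      (Finset.mem_Icc.2 ⟨hc, hca⟩))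
    refine le_trans ?_ (Finset.single_le_sum (hnn _)
      (Finset.mem_powersetCard.2 ⟨Finset.inter_subset_left, rfl⟩))
    rw [if_pos Finset.inter_subset_right]
    linarith
  · rw [Nat.choose_eq_zero_of_lt (by omega)]
    simpa using Finset.sum_nonneg fun l _ => Finset.sum_nonneg (hnn l)

theorem sum_inv_pow_choose_two_card_inter_sub_one_le {n a : ℕ} {q : ℝ} (hq : 0 < q) (ha : a ≤ n)
    {S : Finset (Fin n)} (hS : S.card = a) :
    ∑ T ∈ Finset.powersetCard a Finset.univ, ((q ^ (S ∩ T).card.choose 2)⁻¹ - 1) ≤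
      (n.choose a : ℝ) * ∑ l ∈ Finset.Icc 2 a, (a.choose l : ℝ) ^ 2 / muNat n l q := by
  refine (Finset.sum_le_sum fun T _ =>
    inv_pow_choose_two_card_inter_sub_one_le (T := T) hq hS).trans (le_of_eq ?_)
  rw [Finset.sum_comm, Finset.mul_sum]
  refine Finset.sum_congr rfl fun l hl => ?_
  have hla : l ≤ a := (Finset.mem_Icc.1 hl).2
  rw [Finset.sum_comm]
  have hterm : ∀ U ∈ Finset.powersetCard l S,
      ∑ T ∈ Finset.powersetCard a (Finset.univ : Finset (Fin n)),
        (if U ⊆ T then (q ^ l.choose 2)⁻¹ else 0) =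
      ((n - l).choose (a - l) : ℝ) * (q ^ l.choose 2)⁻¹ := by
    intro U hU
    have hU := (Finset.mem_powersetCard.1 hU).2
    rw [← Finset.sum_filter, Finset.sum_const,
      Finset.card_filter_powersetCard_subset U _ _ (Finset.subset_univ U) (by omega), hU,
      Finset.card_univ, Fintype.card_fin, nsmul_eq_mul]
  have hchoose : (n.choose a : ℝ) * a.choose l = n.choose l * (n - l).choose (a - l) := by
    exact_mod_cast Nat.choose_mul hla
  have hpos : (0 : ℝ) < n.choose l := Nat.cast_pos.2 (Nat.choose_pos (hla.trans ha))
  rw [Finset.sum_congr rfl hterm, Finset.sum_const, Finset.card_powersetCard, nsmul_eq_mul, hS,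
    muNat]
  field_simp
  linear_combination -(a.choose l : ℝ) * hchoose

theorem sum_gnpWeight_mul_numIndep_sq_le {n a : ℕ} {p : ℝ} (hp1 : p < 1) (ha : a ≤ n) :
    ∑ H : SimpleGraph (Fin n), gnpWeight n p H * numIndep a H ^ 2 ≤
      muNat n a (1 - p) ^ 2 *
        (1 + ∑ l ∈ Finset.Icc 2 a, (a.choose l : ℝ) ^ 2 / muNat n l (1 - p)) := by
  classical
  have hq : 0 < 1 - p := sub_pos.2 hp1
  set q := 1 - p with hqdef
  set 𝒮 := Finset.powersetCard a (Finset.univ : Finset (Fin n)) with h𝒮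
  have hcard : ∀ S ∈ 𝒮, S.card = a := fun S hS => (Finset.mem_powersetCard.1 hS).2
  have hcard𝒮 : (𝒮.card : ℝ) = n.choose a := by simp [h𝒮]
  have hexpand : ∑ H : SimpleGraph (Fin n), gnpWeight n p H * numIndep a H ^ 2 =
      ∑ S ∈ 𝒮, ∑ T ∈ 𝒮, q ^ (pairs S ∪ pairs T).card := by
    simp_rw [hqdef, ← sum_gnpWeight_isIndepSet_and p]
    simp_rw [Finset.sum_comm (s := 𝒮) (t := (Finset.univ : Finset (SimpleGraph (Fin n))))]
    refine Finset.sum_congr rfl fun H _ => ?_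
    rw [numIndep, sq, Finset.sum_mul_sum, Finset.mul_sum]
    refine Finset.sum_congr rfl fun S _ => ?_
    rw [Finset.mul_sum]
    refine Finset.sum_congr rfl fun T _ => ?_
    by_cases h1 : H.IsIndepSet S <;> by_cases h2 : H.IsIndepSet T <;> simp [h1, h2]
  have hpow : ∀ S ∈ 𝒮, ∀ T ∈ 𝒮, q ^ (pairs S ∪ pairs T).card =
      (q ^ a.choose 2) ^ 2 * (1 + ((q ^ (S ∩ T).card.choose 2)⁻¹ - 1)) := by
    intro S hS T hT
    have := Finset.card_union_add_card_inter (pairs S) (pairs T)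
    rw [← pairs_inter, card_pairs, card_pairs, card_pairs, hcard S hS, hcard T hT] at this
    rw [add_sub_cancel, eq_mul_inv_iff_mul_eq₀ (pow_pos hq _).ne', ← pow_add, this, ← pow_mul,
      mul_two]
  rw [hexpand]
  calc ∑ S ∈ 𝒮, ∑ T ∈ 𝒮, q ^ (pairs S ∪ pairs T).card
      = (q ^ a.choose 2) ^ 2 * ∑ S ∈ 𝒮, ((n.choose a : ℝ) +
          ∑ T ∈ 𝒮, ((q ^ (S ∩ T).card.choose 2)⁻¹ - 1)) := by
        rw [Finset.mul_sum]
        refine Finset.sum_congr rfl fun S hS => ?_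
        rw [Finset.sum_congr rfl (hpow S hS), ← Finset.mul_sum, Finset.sum_add_distrib,
          Finset.sum_const, nsmul_eq_mul, mul_one, hcard𝒮]
    _ ≤ (q ^ a.choose 2) ^ 2 * ∑ S ∈ 𝒮, ((n.choose a : ℝ) + (n.choose a : ℝ) *
          ∑ l ∈ Finset.Icc 2 a, (a.choose l : ℝ) ^ 2 / muNat n l q) := by
        gcongr with S hS
        exact sum_inv_pow_choose_two_card_inter_sub_one_le hq ha (hcard S hS)
    _ = _ := by
        rw [Finset.sum_const, nsmul_eq_mul, hcard𝒮, muNat]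
        ring

/-- The total variation distance between `G_{n,p}` and its planted version, by the second moment
method. -/
theorem sq_sum_abs_gnpWeight_sub_plantedWeight_le {n a : ℕ} {p : ℝ} (hp0 : 0 < p) (hp1 : p < 1)
    (ha : a ≤ n) :
    (∑ H : SimpleGraph (Fin n), |plantedWeight n p a H - gnpWeight n p H|) ^ 2 ≤
      ∑ l ∈ Finset.Icc 2 a, (a.choose l : ℝ) ^ 2 / muNat n l (1 - p) := by
  have hμ : 0 < muNat n a (1 - p) := muNat_pos ha (sub_pos.2 hp1)
  set μ := muNat n a (1 - p) with hμdef
  have hsq : ∀ H : SimpleGraph (Fin n), |plantedWeight n p a H - gnpWeight n p H| ^ 2 ≤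
      gnpWeight n p H * (gnpWeight n p H * (numIndep a H / μ - 1) ^ 2) := by
    intro H
    rw [sq_abs, plantedWeight]
    exact le_of_eq (by ring)
  refine (Finset.sum_sq_le_sum_mul_sum_of_sq_le_mul Finset.univ
    (fun H _ => (gnpWeight_pos hp0 hp1 H).le)
    (fun H _ => mul_nonneg (gnpWeight_pos hp0 hp1 H).le (sq_nonneg _))
    (fun H _ => hsq H)).trans ?_
  rw [sum_gnpWeight, one_mul]
  have hexp : ∀ H : SimpleGraph (Fin n), gnpWeight n p H * (numIndep a H / μ - 1) ^ 2 =
      gnpWeight n p H * numIndep a H ^ 2 / μ ^ 2 - 2 * (gnpWeight n p H * numIndep a H) / μ +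
        gnpWeight n p H := by
    intro H
    field_simp
    ring
  simp_rw [hexp, Finset.sum_add_distrib, Finset.sum_sub_distrib, ← Finset.sum_div,
    ← Finset.mul_sum]
  rw [sum_gnpWeight, sum_gnpWeight_mul_numIndep, ← hμdef, mul_div_assoc, div_self hμ.ne']
  have := (div_le_iff₀' (pow_pos hμ 2)).2 (sum_gnpWeight_mul_numIndep_sq_le (n := n) hp1 ha)
  linarith

theorem sum_plantedWeight {n a : ℕ} {p : ℝ} (hp1 : p < 1) (ha : a ≤ n) :
    ∑ H : SimpleGraph (Fin n), plantedWeight n p a H = 1 := by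
  simp_rw [plantedWeight]
  rw [← Finset.sum_div, sum_gnpWeight_mul_numIndep,
    div_self (muNat_pos ha (sub_pos.2 hp1)).ne']

theorem plantedWeight_nonneg {n a : ℕ} {p : ℝ} (hp0 : 0 < p) (hp1 : p < 1) (ha : a ≤ n)
    (H : SimpleGraph (Fin n)) : 0 ≤ plantedWeight n p a H :=
  div_nonneg (mul_nonneg (gnpWeight_pos hp0 hp1 H).le (numIndep_nonneg a H))
    (muNat_pos ha (sub_pos.2 hp1)).le

theorem muNat_le_muNat {n N l : ℕ} {q : ℝ} (hq : 0 ≤ q) (hnN : n ≤ N) :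
    muNat n l q ≤ muNat N l q := by
  unfold muNat
  gcongr

/-- One step of the coupling: adding `a` vertices costs at most one new colour. -/
theorem hasCoupling_add {n m a : ℕ} {p ε : ℝ} (hp0 : 0 < p) (hp1 : p < 1) (ha : a ≤ n)
    (hnm : n ≤ m) (hε : 0 ≤ ε)
    (h : ∑ l ∈ Finset.Icc 2 a, (a.choose l : ℝ) ^ 2 / muNat n l (1 - p) ≤ ε ^ 2) :
    HasCoupling (gnpWeight m p) (gnpWeight (m + a) p) (fun G H => chrom H ≤ chrom G + 1)
      (ε / 2) := by
  have hq : 0 < 1 - p := sub_pos.2 hp1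
  have haN : a ≤ m + a := Nat.le_add_left a m
  have htv := HasCoupling.of_totalVariation (plantedWeight_nonneg hp0 hp1 haN)
    (fun H => (gnpWeight_pos hp0 hp1 H).le)
    ((sum_plantedWeight hp1 haN).trans (sum_gnpWeight (m + a) p).symm)
  have hbound : ∑ H : SimpleGraph (Fin (m + a)),
      |plantedWeight (m + a) p a H - gnpWeight (m + a) p H| ≤ ε := by
    refine abs_le_of_sq_le_sq' ?_ hε |>.2
    refine (sq_sum_abs_gnpWeight_sub_plantedWeight_le hp0 hp1 haN).trans (le_trans ?_ h)
    refine Finset.sum_le_sum fun l hl => ?_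
    have hl : l ≤ n := (Finset.mem_Icc.1 hl).2.trans ha
    exact div_le_div_of_nonneg_left (sq_nonneg _) (muNat_pos hl hq)
      (muNat_le_muNat hq.le (by omega))
  have := HasCoupling.comp (T := fun G H => chrom H ≤ chrom G + 1)
    (by rintro x y z hxy rfl; exact hxy) (hasCoupling_plantedWeight hp0 hp1 m a) htv
  exact this.mono (by linarith)

theorem hasCoupling_add_mul {n a : ℕ} {p ε : ℝ} (hp0 : 0 < p) (hp1 : p < 1) (ha : a ≤ n)
    (hε : 0 ≤ ε)
    (h : ∑ l ∈ Finset.Icc 2 a, (a.choose l : ℝ) ^ 2 / muNat n l (1 - p) ≤ ε ^ 2) (r : ℕ) :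
    HasCoupling (gnpWeight n p) (gnpWeight (n + a * r) p) (fun G H => chrom H ≤ chrom G + r)
      (r * (ε / 2)) := by
  induction r with
  | zero =>
    simpa using HasCoupling.refl (fun G => (gnpWeight_pos hp0 hp1 G).le)
      (R := fun G H : SimpleGraph (Fin n) => chrom H ≤ chrom G + 0) (fun G => by simp)
  | succ r ih =>
    have hstep := hasCoupling_add (m := n + a * r) hp0 hp1 ha (Nat.le_add_right _ _) hε h
    have := HasCoupling.comp (T := fun G H => chrom H ≤ chrom G + (r + 1))
      (fun x y z hxy hyz => by omega) ih hstep
    rw [show n + a * (r + 1) = n + a * r + a by ring]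
    refine this.mono (le_of_eq ?_)
    push_cast
    ring

theorem HasCoupling.exists_coupling {n m k : ℕ} {p ε : ℝ}
    (h : HasCoupling (gnpWeight n p) (gnpWeight m p) (fun G H => chrom H ≤ chrom G + k) ε) :
    ∃ c : Coupling p n m, 1 - ε ≤ couplingProb c {x | chrom x.2 ≤ chrom x.1 + k} := by
  classical
  obtain ⟨w, hw, hf⟩ := h
  refine ⟨⟨fun x => w x.1 x.2, fun x => hw.nonneg _ _, hw.sum_right, hw.sum_left⟩, ?_⟩
  have htotal : couplingProb (⟨fun x => w x.1 x.2, fun x => hw.nonneg _ _, hw.sum_right,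
      hw.sum_left⟩ : Coupling p n m) {x | chrom x.2 ≤ chrom x.1 + k} +
      violation w (fun G H => chrom H ≤ chrom G + k) = 1 := by
    rw [couplingProb, violation, Fintype.sum_prod_type, ← Finset.sum_add_distrib,
      ← sum_gnpWeight n p]
    refine Finset.sum_congr rfl fun G _ => ?_
    rw [← Finset.sum_add_distrib, ← hw.sum_right]
    refine Finset.sum_congr rfl fun H _ => ?_
    simp only [Set.mem_ofPred_eq]
    split_ifs <;> simp
  linarith

theorem choose_sq_div_muNat_le {n a l : ℕ} {s t : ℝ} (ht : 0 < t) (ha : 0 < a)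
    (hla : l ≤ a) (han : 2 * a ≤ n) (hts : t ≤ s ^ (l - 1)) :
    (a.choose l : ℝ) ^ 2 / muNat n l (s ^ 2) ≤ (2 * (a : ℝ) ^ 3 / (n * t)) ^ l := by
  have ha' : (0 : ℝ) < a := Nat.cast_pos.2 ha
  have hn' : (0 : ℝ) < n := Nat.cast_pos.2 (by omega)
  have hpow : (s ^ 2) ^ l.choose 2 = (s ^ (l - 1)) ^ l := by
    rw [← pow_mul, ← pow_mul, Nat.choose_two_right,
      Nat.mul_div_cancel' (Nat.even_mul_pred_self l).two_dvd, mul_comm]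
  have hchoose : ((n : ℝ) / (2 * a)) ^ l ≤ n.choose l := by
    refine le_trans ?_ (Nat.pow_le_choose l n)
    rw [div_pow, mul_pow, ← div_div, ← div_pow]
    have h1 : (n : ℝ) / 2 ≤ ((n + 1 - l : ℕ) : ℝ) := by
      rw [div_le_iff₀ two_pos]
      exact_mod_cast (show n ≤ (n + 1 - l) * 2 by omega)
    have h2 : ((l.factorial : ℕ) : ℝ) ≤ (a : ℝ) ^ l := by
      exact_mod_cast (Nat.factorial_le_pow l).trans (Nat.pow_le_pow_left hla l)
    have h3 : (0 : ℝ) < (l.factorial : ℕ) := Nat.cast_pos.2 l.factorial_pos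
    gcongr
  have hmu : ((n : ℝ) / (2 * a) * t) ^ l ≤ muNat n l (s ^ 2) := by
    rw [muNat, hpow, mul_pow]
    gcongr
  calc (a.choose l : ℝ) ^ 2 / muNat n l (s ^ 2)
      ≤ ((a : ℝ) ^ l) ^ 2 / ((n : ℝ) / (2 * a) * t) ^ l := by
        gcongr
        exact_mod_cast Nat.choose_le_pow a l
    _ = (2 * (a : ℝ) ^ 3 / (n * t)) ^ l := by
        rw [← pow_mul, mul_comm l 2, pow_mul, ← div_pow]
        congr 1
        field_simp

theorem muNat_add_le {n l : ℕ} {q : ℝ} (hq0 : 0 < q) (hq1 : q ≤ 1) (k : ℕ) :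
    muNat n (l + k) q ≤ muNat n l q * (n * q ^ l) ^ k := by
  induction k with
  | zero => simp
  | succ k ih =>
    have hstep : muNat n (l + k + 1) q ≤ muNat n (l + k) q * (n * q ^ l) := by
      have h1 : (n.choose (l + k + 1) : ℝ) ≤ n.choose (l + k) * n := by
        have := Nat.choose_succ_right_eq n (l + k)
        have h2 : n.choose (l + k + 1) ≤ n.choose (l + k) * n :=
          calc n.choose (l + k + 1) ≤ n.choose (l + k + 1) * (l + k + 1) :=
                Nat.le_mul_of_pos_right _ (Nat.succ_pos _)
            _ = n.choose (l + k) * (n - (l + k)) := this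
            _ ≤ n.choose (l + k) * n := Nat.mul_le_mul_left _ (Nat.sub_le _ _)
        exact_mod_cast h2
      have h3 : q ^ (l + k) ≤ q ^ l := pow_le_pow_of_le_one hq0.le hq1 (Nat.le_add_right _ _)
      rw [muNat, muNat, show (l + k + 1).choose 2 = (l + k).choose 2 + (l + k) by
        rw [Nat.choose_succ_succ' (l + k) 1, Nat.choose_one_right, add_comm], pow_add]
      calc (n.choose (l + k + 1) : ℝ) * (q ^ (l + k).choose 2 * q ^ (l + k))
          ≤ (n.choose (l + k) * n) * (q ^ (l + k).choose 2 * q ^ l) := by gcongr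
        _ = _ := by ring
    calc muNat n (l + (k + 1)) q ≤ muNat n (l + k) q * (n * q ^ l) := hstep
      _ ≤ muNat n l q * (n * q ^ l) ^ k * (n * q ^ l) := by gcongr
      _ = _ := by ring

theorem tendsto_const_mul_log_pow_mul_rpow_neg (C c : ℝ) (k : ℕ) {e : ℝ} (he : 0 < e) :
    Tendsto (fun n : ℕ => C * (c * Real.log n) ^ k * (n : ℝ) ^ (-e)) atTop (nhds 0) := by
  have h := ((isLittleO_log_rpow_rpow_atTop (k : ℝ) he).tendsto_div_nhds_zero.comp
    tendsto_natCast_atTop_atTop).const_mul (C * c ^ k)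
  rw [mul_zero] at h
  refine h.congr fun n => ?_
  simp only [Function.comp_apply, Real.rpow_natCast]
  rw [Real.rpow_neg (Nat.cast_nonneg n), mul_pow]
  ring

theorem mul_muNat_mul_choose_sq_div_muNat_le {n a l : ℕ} {q y : ℝ} (hq0 : 0 < q) (hq1 : q < 1)
    (hn : 0 < n) (hl2 : 2 ≤ l) (hla : l < a) (hay : a ≤ y) (han : 2 * a ≤ n)
    (hμ : muNat n a q ≤ (n : ℝ) ^ (1.98 : ℝ))
    (h₁ : 1 * y ^ 3 * (n : ℝ) ^ (-(0.01 : ℝ)) ≤ 0.4)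
    (h₂ : 4 / √q ^ 6 * y ^ 7 * (n : ℝ) ^ (-(0.02 : ℝ)) ≤ 0.4)
    (h₃ : 2 / √q ^ 3 * y ^ 3 * (n : ℝ) ^ (-(1 : ℝ)) ≤ 0.4)
    (h₄ : 32 * y ^ 16 * (n : ℝ) ^ (-(0.495 : ℝ)) ≤ 0.4)
    (h₅ : 2 * y ^ 3 * (n : ℝ) ^ (-(0.495 : ℝ)) ≤ 0.4) :
    a * (muNat n a q * ((a.choose l : ℝ) ^ 2 / muNat n l q)) ≤ 0.4 := by
  have hn' : (0 : ℝ) < n := Nat.cast_pos.2 hn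
  have ha1 : (1 : ℝ) ≤ a := by exact_mod_cast (by omega : 1 ≤ a)
  have ha0 : (0 : ℝ) < a := by linarith
  have hy1 : 1 ≤ y := ha1.trans hay
  set s := √q with hsdef
  have hs0 : 0 < s := Real.sqrt_pos.2 hq0
  have hs1 : s ≤ 1 := Real.sqrt_le_one.2 hq1.le
  have hsq : s ^ 2 = q := Real.sq_sqrt hq0.le
  have hμl : 0 < muNat n l q := muNat_pos (by omega) hq0
  by_cases hbig : q ^ l ≤ (n : ℝ) ^ (-(1.01 : ℝ))
  · obtain ⟨k, rfl⟩ : ∃ k, a = l + k := ⟨a - l, by omega⟩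
    have hk : k ≠ 0 := by omega
    have hnq : (n : ℝ) * q ^ l ≤ (n : ℝ) ^ (-(0.01 : ℝ)) := by
      calc (n : ℝ) * q ^ l ≤ (n : ℝ) ^ (1 : ℝ) * (n : ℝ) ^ (-(1.01 : ℝ)) := by
            rw [Real.rpow_one]; gcongr
        _ = (n : ℝ) ^ (-(0.01 : ℝ)) := by rw [← Real.rpow_add hn']; norm_num
    set x := (n : ℝ) ^ (-(0.01 : ℝ)) with hx
    have hx0 : 0 < x := Real.rpow_pos_of_pos hn' _
    set A : ℝ := ((l + k : ℕ) : ℝ) with hA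
    have hAx : A ^ 3 * x ≤ 0.4 :=
      le_trans (by rw [one_mul]; gcongr) h₁
    have hAx2 : A ^ 2 * x ≤ 1 := by
      have : A ^ 2 * x ≤ A ^ 3 * x := by gcongr; norm_num
      linarith
    have hchoose : ((l + k).choose l : ℝ) ≤ A ^ k := by
      rw [Nat.choose_symm_add, hA]
      exact_mod_cast Nat.choose_le_pow (l + k) k
    have hmain : muNat n (l + k) q * (((l + k).choose l : ℝ) ^ 2 / muNat n l q) ≤
        (A ^ 2 * x) ^ k := by
      rw [mul_div_assoc', div_le_iff₀ hμl]
      calc muNat n (l + k) q * ((l + k).choose l : ℝ) ^ 2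
          ≤ (muNat n l q * (n * q ^ l) ^ k) * (A ^ k) ^ 2 := by
            gcongr
            exact muNat_add_le hq0 hq1.le k
        _ ≤ (muNat n l q * x ^ k) * (A ^ k) ^ 2 := by gcongr
        _ = _ := by ring
    calc A * (muNat n (l + k) q * (((l + k).choose l : ℝ) ^ 2 / muNat n l q))
        ≤ A * (A ^ 2 * x) ^ 1 := by
          gcongr
          exact hmain.trans (pow_le_pow_of_le_one (by positivity) hAx2 (by omega))
      _ = A ^ 3 * x := by ring
      _ ≤ 0.4 := hAx
  · by_cases hl4 : l ≤ 4
    · have hts : s ^ 3 ≤ s ^ (l - 1) := pow_le_pow_of_le_one hs0.le hs1 (by omega)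
      have hlem := choose_sq_div_muNat_le (pow_pos hs0 3) (by omega : 0 < a) hla.le han hts
      rw [hsq] at hlem
      have hle1 : 2 * (a : ℝ) ^ 3 / (n * s ^ 3) ≤ 1 := by
        calc 2 * (a : ℝ) ^ 3 / (n * s ^ 3) ≤ 2 * y ^ 3 / (n * s ^ 3) := by gcongr
          _ = 2 / s ^ 3 * y ^ 3 * (n : ℝ) ^ (-(1 : ℝ)) := by
            rw [Real.rpow_neg_one]; field_simp
          _ ≤ 1 := by linarith
      have hn2 : (n : ℝ) ^ (1.98 : ℝ) / (n : ℝ) ^ 2 = (n : ℝ) ^ (-(0.02 : ℝ)) := by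
        rw [← Real.rpow_natCast, ← Real.rpow_sub hn']; norm_num
      calc a * (muNat n a q * ((a.choose l : ℝ) ^ 2 / muNat n l q))
          ≤ a * ((n : ℝ) ^ (1.98 : ℝ) * (2 * (a : ℝ) ^ 3 / (n * s ^ 3)) ^ 2) := by
            gcongr
            exact hlem.trans (pow_le_pow_of_le_one (by positivity) hle1 hl2)
        _ = 4 / s ^ 6 * (a : ℝ) ^ 7 * ((n : ℝ) ^ (1.98 : ℝ) / (n : ℝ) ^ 2) := by
            field_simp
            norm_num
        _ ≤ 4 / s ^ 6 * y ^ 7 * (n : ℝ) ^ (-(0.02 : ℝ)) := by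
            rw [hn2]; gcongr
        _ ≤ 0.4 := h₂
    · push Not at hbig hl4
      have ht0 : 0 < (n : ℝ) ^ (-(0.505 : ℝ)) := Real.rpow_pos_of_pos hn' _
      have hts : (n : ℝ) ^ (-(0.505 : ℝ)) ≤ s ^ (l - 1) := by
        refine le_trans ?_ (pow_le_pow_of_le_one hs0.le hs1 (Nat.sub_le l 1))
        refine le_of_sq_le_sq ?_ (by positivity)
        calc ((n : ℝ) ^ (-(0.505 : ℝ))) ^ 2 = (n : ℝ) ^ (-(1.01 : ℝ)) := by
              rw [← Real.rpow_natCast, ← Real.rpow_mul hn'.le]; norm_num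
          _ ≤ q ^ l := hbig.le
          _ = (s ^ l) ^ 2 := by rw [← hsq, ← pow_mul, ← pow_mul, mul_comm]
      have hlem := choose_sq_div_muNat_le ht0 (by omega : 0 < a) hla.le han hts
      have hbase : 2 * (a : ℝ) ^ 3 / (n * (n : ℝ) ^ (-(0.505 : ℝ))) =
          2 * (a : ℝ) ^ 3 * (n : ℝ) ^ (-(0.495 : ℝ)) := by
        rw [div_eq_mul_inv]
        congr 1
        nth_rewrite 1 [← Real.rpow_one (n : ℝ)]
        rw [← Real.rpow_add hn', ← Real.rpow_neg hn'.le]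
        norm_num
      rw [hsq, hbase] at hlem
      have hle1 : 2 * (a : ℝ) ^ 3 * (n : ℝ) ^ (-(0.495 : ℝ)) ≤ 1 := by
        refine le_trans ?_ (h₅.trans (by norm_num))
        gcongr
      have hn5 : (n : ℝ) ^ (1.98 : ℝ) * ((n : ℝ) ^ (-(0.495 : ℝ))) ^ 5 =
          (n : ℝ) ^ (-(0.495 : ℝ)) := by
        rw [← Real.rpow_natCast, ← Real.rpow_mul hn'.le, ← Real.rpow_add hn']; norm_num
      calc a * (muNat n a q * ((a.choose l : ℝ) ^ 2 / muNat n l q))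
          ≤ a * ((n : ℝ) ^ (1.98 : ℝ) * (2 * (a : ℝ) ^ 3 * (n : ℝ) ^ (-(0.495 : ℝ))) ^ 5) := by
            gcongr
            exact hlem.trans (pow_le_pow_of_le_one (by positivity) hle1 (by omega))
        _ = 32 * (a : ℝ) ^ 16 *
            ((n : ℝ) ^ (1.98 : ℝ) * ((n : ℝ) ^ (-(0.495 : ℝ))) ^ 5) := by ring
        _ ≤ 32 * y ^ 16 * (n : ℝ) ^ (-(0.495 : ℝ)) := by
            rw [hn5]; gcongr
        _ ≤ 0.4 := h₄

theorem exists_sum_choose_sq_div_muNat_le {q : ℝ} (hq0 : 0 < q) (hq1 : q < 1) (c : ℝ) :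
    ∃ n₀ : ℕ, ∀ n : ℕ, n₀ ≤ n → ∀ a : ℕ, 1 ≤ a → a ≤ n → (a : ℝ) ≤ c * Real.log n →
      muNat n a q ≤ (n : ℝ) ^ (1.98 : ℝ) →
      ∑ l ∈ Finset.Icc 2 a, (a.choose l : ℝ) ^ 2 / muNat n l q ≤ 1.4 / muNat n a q := by
  have hev : ∀ (C : ℝ) (k : ℕ) {e : ℝ}, 0 < e →
      ∀ᶠ n : ℕ in atTop, C * (c * Real.log n) ^ k * (n : ℝ) ^ (-e) ≤ 0.4 := fun C k e he =>
    (tendsto_const_mul_log_pow_mul_rpow_neg C c k he).eventually_le_const (by norm_num)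
  obtain ⟨n₀, hn₀⟩ := eventually_atTop.1 <|
    (hev 1 3 (e := 0.01) (by norm_num)).and <|
    (hev (4 / √q ^ 6) 7 (e := 0.02) (by norm_num)).and <|
    (hev (2 / √q ^ 3) 3 (e := 1) (by norm_num)).and <|
    (hev 32 16 (e := 0.495) (by norm_num)).and <|
    (hev 2 3 (e := 0.495) (by norm_num)).and <|
    (hev 1 1 (e := 1) (by norm_num))
  refine ⟨n₀, fun n hn a ha1 han hac hμ => ?_⟩
  obtain ⟨h₁, h₂, h₃, h₄, h₅, h₆⟩ := hn₀ n hn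
  have hn0 : 0 < n := by omega
  have hn' : (0 : ℝ) < n := Nat.cast_pos.2 hn0
  have ha0 : (0 : ℝ) < a := Nat.cast_pos.2 ha1
  have hμ0 : 0 < muNat n a q := muNat_pos han hq0
  have h2a : 2 * a ≤ n := by
    rw [one_mul, pow_one, Real.rpow_neg_one, ← div_eq_mul_inv, div_le_iff₀ hn'] at h₆
    have : (2 * a : ℝ) ≤ n := by linarith
    exact_mod_cast this
  have hterm : ∀ l ∈ Finset.Ico 2 a,
      (a.choose l : ℝ) ^ 2 / muNat n l q ≤ 0.4 / (a * muNat n a q) := by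
    intro l hl
    obtain ⟨hl2, hla⟩ := Finset.mem_Ico.1 hl
    rw [le_div_iff₀ (mul_pos ha0 hμ0)]
    refine le_trans (le_of_eq (by ring)) (mul_muNat_mul_choose_sq_div_muNat_le hq0 hq1 hn0 hl2 hla
      hac h2a hμ h₁ h₂ h₃ h₄ h₅)
  have hsum : ∑ l ∈ Finset.Ico 2 a, (a.choose l : ℝ) ^ 2 / muNat n l q ≤ 0.4 / muNat n a q :=
    calc ∑ l ∈ Finset.Ico 2 a, (a.choose l : ℝ) ^ 2 / muNat n l q
        ≤ (Finset.Ico 2 a).card • (0.4 / (a * muNat n a q)) := Finset.sum_le_card_nsmul _ _ _ hterm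
      _ ≤ a * (0.4 / (a * muNat n a q)) := by
          rw [nsmul_eq_mul, Nat.card_Ico]
          gcongr
          omega
      _ = 0.4 / muNat n a q := by field_simp
  by_cases ha2 : 2 ≤ a
  · rw [← Finset.Ico_insert_right ha2, Finset.sum_insert (by simp), Nat.choose_self]
    calc _ ≤ ((1 : ℕ) : ℝ) ^ 2 / muNat n a q + 0.4 / muNat n a q := by gcongr
      _ = 1.4 / muNat n a q := by rw [← add_div]; norm_num
  · rw [Finset.Icc_eq_empty ha2, Finset.sum_empty]
    positivity

/-- **iterated coupling.** Let `p ∈ (0,1)` and `b = 1/(1-p)`.  There is `n₀`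
such that for all `n ≥ n₀`, every integer `1 ≤ a ≤ n` with `1.02 log_b n ≤ a ≤ 99 log_b n`
and `μ ≤ n^{1.98}` (where `μ = C(n,a)(1-p)^C(a,2)`), and every integer `r ≤ √μ`, there is a
coupling of `G_{n,p}` and `G_{n+ar,p}` with `P(χ(G_{n+ar}) ≤ χ(G_n) + r) > 0.4`. -/
theorem coupling_corollary (p : ℝ) (hp0 : 0 < p) (hp1 : p < 1) :
    ∃ n₀ : ℕ, ∀ n : ℕ, n₀ ≤ n → ∀ a : ℕ, 1 ≤ a → a ≤ n →
      1.02 * Real.logb (1 / (1 - p)) n ≤ (a : ℝ) →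
      (a : ℝ) ≤ 99 * Real.logb (1 / (1 - p)) n →
      muNat n a (1 - p) ≤ (n : ℝ) ^ (1.98 : ℝ) →
      ∀ r : ℕ, (r : ℝ) ≤ Real.sqrt (muNat n a (1 - p)) →
      ∃ c : Coupling p n (n + a * r),
        0.4 < couplingProb c {x | chrom x.2 ≤ chrom x.1 + r} := by
  have hq0 : 0 < 1 - p := sub_pos.2 hp1
  have hq1 : 1 - p < 1 := by linarith
  obtain ⟨n₀, hn₀⟩ := exists_sum_choose_sq_div_muNat_le hq0 hq1 (99 / Real.log (1 / (1 - p)))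
  refine ⟨n₀, fun n hn a ha1 han _ hac hμ r hr => ?_⟩
  have hac' : (a : ℝ) ≤ 99 / Real.log (1 / (1 - p)) * Real.log n :=
    hac.trans_eq (by rw [Real.logb]; ring)
  have hμ0 : 0 < muNat n a (1 - p) := muNat_pos han hq0
  set μ := muNat n a (1 - p) with hμdef
  have hsum := hn₀ n hn a ha1 han hac' hμ
  have hε : 0 ≤ √(1.4 / μ) := Real.sqrt_nonneg _
  rw [← Real.sq_sqrt (show 0 ≤ 1.4 / μ by positivity)] at hsum
  obtain ⟨c, hc⟩ := (hasCoupling_add_mul hp0 hp1 han hε hsum r).exists_coupling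
  refine ⟨c, lt_of_lt_of_le ?_ hc⟩
  have hsqrt : √(1.4 / μ) = √1.4 / √μ := Real.sqrt_div (by norm_num) _
  have hlt : √(1.4 : ℝ) < 1.2 := (Real.sqrt_lt' (by norm_num)).2 (by norm_num)
  have hbound : r * √(1.4 / μ) ≤ √1.4 := by
    rw [hsqrt, mul_div_assoc', div_le_iff₀ (Real.sqrt_pos.2 hμ0), mul_comm]
    gcongr
  linarith
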